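/- Let n ≥ 2 and let D be a set of k distinct card labels, 1 ≤ k ≤ n. For a deck of n cards after t inverse riffle shuffles, starting from any fixed order, the total variation distance between the joint distribution of the positions of the k cards in D (as an injective function D → positions) and the uniform distribution on all injective functions D → Fin n is at most (n·k − k(k+1)/2)/2^t. In particular it is at most n·k/2^t, so for ε > 0 it is at most ε once t ≥ log₂(n) + log₂(k) − log₂(ε). -/

import Mathlib

open scoped Classical

/-- Total variation distance between two probability distributions on a finite type. -/
noncomputable def tvDist {Ω : Type*} [Fintype Ω] (μ ν : PMF Ω) : ℝ :=
  (1 / 2) * ∑ a, |(μ a).toReal - (ν a).toReal|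

/-- The value of a bit string, reading the first coordinate as most significant (so comparison of
values is lexicographic comparison of strings). -/
def strVal (t : ℕ) (s : Fin t → Bool) : ℕ :=
  ∑ i : Fin t, if s i then 2 ^ (t - 1 - (i : ℕ)) else 0

/-- The deck obtained from the deck order `σ₀` (where `σ₀ p` is the label of the card in
position `p`, position `0` being the top) after `t` inverse riffle shuffles realised by the bit
strings `s`: the card with label `c` is assigned the string `s c` and the deck is sorted stably
by these strings (cards with lexicographically smaller strings nearer the top, cards with equal
strings keeping their original relative order). -/
noncomputable def riffleResult {n : ℕ} (t : ℕ) (σ₀ : Equiv.Perm (Fin n))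
    (s : Fin n → Fin t → Bool) : Equiv.Perm (Fin n) :=
  (Tuple.sort (fun p => strVal t (s (σ₀ p)))).trans σ₀

theorem strVal_succ (t : ℕ) (s : Fin (t + 1) → Bool) :
    strVal (t + 1) s = (if s 0 then 2 ^ t else 0) + strVal t (fun i => s i.succ) := by
  unfold strVal
  rw [Fin.sum_univ_succ]
  congr 1
  apply Finset.sum_congr rfl
  intro i _
  have : t + 1 - 1 - ((i.succ : Fin (t+1)) : ℕ) = t - 1 - (i : ℕ) := by
    rw [Fin.val_succ]; omega
  rw [this]

theorem strVal_lt (t : ℕ) (s : Fin t → Bool) : strVal t s < 2 ^ t := by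
  induction t with
  | zero => simp [strVal]
  | succ t ih =>
    rw [strVal_succ, pow_succ]
    have := ih (fun i => s i.succ)
    split_ifs <;> omega

theorem strVal_injective (t : ℕ) : Function.Injective (strVal t) := by
  induction t with
  | zero => intro a b _; exact Subsingleton.elim _ _
  | succ t ih =>
    intro a b h
    rw [strVal_succ, strVal_succ] at h
    have ha := strVal_lt t (fun i => a i.succ)
    have hb := strVal_lt t (fun i => b i.succ)
    have h0 : a 0 = b 0 := by
      cases h1 : a 0 <;> cases h2 : b 0 <;> simp [h1, h2] at h ⊢ <;> omega
    rw [h0] at h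
    have h1 := ih (Nat.add_left_cancel h)
    funext i
    refine Fin.cases h0 (fun j => ?_) i
    exact congrFun h1 j

/-- In a sorted deck a value without ties sits at the position counting smaller values. -/
theorem sort_symm_val {n : ℕ} (f : Fin n → ℕ) (p : Fin n) (hp : ∀ q, q ≠ p → f q ≠ f p) :
    (((Tuple.sort f).symm p : Fin n) : ℕ) = (Finset.univ.filter (fun q => f q < f p)).card := by
  set q := (Tuple.sort f).symm p with hq
  have hqp : Tuple.sort f q = p := by simp [hq]
  have hm := Tuple.monotone_sort f
  have : Finset.univ.filter (fun r => f r < f p)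
      = (Finset.Iio q).map (Tuple.sort f).toEmbedding := by
    ext r
    obtain ⟨r', rfl⟩ := (Tuple.sort f).surjective r
    simp only [Finset.mem_filter, Finset.mem_univ, true_and, Finset.mem_map, Finset.mem_Iio,
      Equiv.coe_toEmbedding, EmbeddingLike.apply_eq_iff_eq, exists_eq_right]
    constructor
    · intro h
      by_contra hc
      have := hm (not_lt.mp hc)
      simp only [Function.comp, hqp] at this
      omega
    · intro h
      have h1 := hm h.le
      simp only [Function.comp, hqp] at h1
      refine lt_of_le_of_ne h1 (hp _ ?_)
      rw [← hqp]
      exact fun he => h.ne ((Tuple.sort f).injective he)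
  rw [this, Finset.card_map, Fin.card_Iio]

theorem riffle_pos_val {n : ℕ} (t : ℕ) (σ : Equiv.Perm (Fin n)) (s : Fin n → Fin t → Bool)
    (d : Fin n) (hd : ∀ c, c ≠ d → s c ≠ s d) :
    ((((riffleResult t σ s)⁻¹ : Equiv.Perm (Fin n)) d : Fin n) : ℕ)
      = (Finset.univ.filter (fun c => strVal t (s c) < strVal t (s d))).card := by
  have h1 : ((riffleResult t σ s)⁻¹ : Equiv.Perm (Fin n)) d
      = (Tuple.sort (fun p => strVal t (s (σ p)))).symm (σ.symm d) := rfl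
  rw [h1, sort_symm_val]
  · apply Finset.card_bij (fun q _ => σ q)
    · intro a ha; simpa using ha
    · intro a _ b _ h; exact σ.injective h
    · intro b hb; exact ⟨σ.symm b, by simpa using hb, by simp⟩
  · intro q hq h
    have h2 := strVal_injective t h
    rw [Equiv.apply_symm_apply] at h2
    refine hd _ ?_ h2
    rintro rfl
    simp at hq

/-- The position map of the cards in `D`. -/
noncomputable def posMap {n : ℕ} (D : Finset (Fin n)) (t : ℕ) (σ : Equiv.Perm (Fin n))
    (s : Fin n → Fin t → Bool) : D → Fin n :=
  fun d : D => (riffleResult t σ s)⁻¹ d.1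

/-- Some card of `D` shares its string with another card. -/
def badEvent {n : ℕ} (D : Finset (Fin n)) (t : ℕ) (s : Fin n → Fin t → Bool) : Prop :=
  ∃ d ∈ D, ∃ c, c ≠ d ∧ s c = s d

theorem posMap_eq {n : ℕ} (D : Finset (Fin n)) (t : ℕ) (σ τ : Equiv.Perm (Fin n))
    (s : Fin n → Fin t → Bool) (h : ¬ badEvent D t s) : posMap D t σ s = posMap D t τ s := by
  funext d
  apply Fin.ext
  have : ∀ c, c ≠ d.1 → s c ≠ s d.1 := fun c hc he => h ⟨d.1, d.2, c, hc, he⟩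
  unfold posMap
  rw [riffle_pos_val t σ s d.1 this, riffle_pos_val t τ s d.1 this]

theorem collide_card {n : ℕ} (t : ℕ) (c d : Fin n) (h : c ≠ d) :
    (Finset.univ.filter (fun s : Fin n → Fin t → Bool => s c = s d)).card * 2 ^ t
      ≤ Fintype.card (Fin n → Fin t → Bool) := by
  have h2 : (2 : ℕ) ^ t = (Finset.univ : Finset (Fin t → Bool)).card := by simp
  rw [h2, ← Finset.card_product, ← Finset.card_univ]
  apply Finset.card_le_card_of_injOn (fun p => Function.update p.1 d p.2)
  · intro _ _; simp
  · rintro ⟨s, b⟩ hs ⟨s', b'⟩ hs' he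
    simp only [Finset.coe_product, Set.mem_prod, Finset.mem_coe, Finset.mem_filter,
      Finset.mem_univ, true_and, and_true] at hs hs'
    simp only at he
    have hb : b = b' := by
      have := congrFun he d
      simpa using this
    have ho : ∀ x, x ≠ d → s x = s' x := by
      intro x hx
      have := congrFun he x
      simpa [Function.update_of_ne hx] using this
    have : s = s' := by
      funext x
      by_cases hx : x = d
      · subst hx; rw [← hs, ← hs', ho c h]
      · exact ho x hx
    rw [this, hb]

theorem pairs_card {n : ℕ} (D : Finset (Fin n)) :
    ((((D ×ˢ Finset.univ).filter
      (fun p : Fin n × Fin n => p.2 ≠ p.1 ∧ (p.2 ∉ D ∨ p.2 < p.1))).card : ℕ) : ℝ)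
      = (n : ℝ) * D.card - D.card * (D.card + 1) / 2 := by
  have hsplit : (D ×ˢ Finset.univ).filter
      (fun p : Fin n × Fin n => p.2 ≠ p.1 ∧ (p.2 ∉ D ∨ p.2 < p.1))
      = (D ×ˢ Dᶜ) ∪ (D.offDiag.filter (fun p => p.2 < p.1)) := by
    ext ⟨a, b⟩
    simp only [Finset.mem_filter, Finset.mem_product, Finset.mem_univ, Finset.mem_union,
      Finset.mem_compl, Finset.mem_offDiag]
    grind
  have hdisj : Disjoint (D ×ˢ Dᶜ) (D.offDiag.filter (fun p => p.2 < p.1)) := by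
    rw [Finset.disjoint_left]
    rintro ⟨a, b⟩ h1 h2
    simp only [Finset.mem_filter, Finset.mem_product, 
      Finset.mem_compl, Finset.mem_offDiag] at h1 h2
    exact h1.2 h2.1.2.1
  have hsym : (D.offDiag.filter (fun p => ¬ p.2 < p.1)).card
      = (D.offDiag.filter (fun p => p.2 < p.1)).card := by
    apply Finset.card_bij (fun p _ => (p.2, p.1))
    · rintro ⟨a, b⟩ h
      simp only [Finset.mem_filter, Finset.mem_offDiag] at h ⊢
      grind
    · rintro ⟨a, b⟩ _ ⟨a', b'⟩ _ h; simp at h; simp [h]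
    · rintro ⟨a, b⟩ h
      simp only [Finset.mem_filter, Finset.mem_offDiag] at h
      refine ⟨(b, a), ?_, rfl⟩
      simp only [Finset.mem_filter, Finset.mem_offDiag]
      grind
  have htot := Finset.card_filter_add_card_filter_not (s := D.offDiag) (fun p => p.2 < p.1)
  rw [hsym, Finset.offDiag_card] at htot
  have hle : D.card ≤ D.card * D.card := Nat.le_mul_self _
  have htot' : (D.card : ℝ) * D.card = 2 * ((D.offDiag.filter (fun p => p.2 < p.1)).card : ℝ)
      + D.card := by
    have : D.card * D.card = 2 * (D.offDiag.filter (fun p => p.2 < p.1)).card + D.card := by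
      omega
    exact_mod_cast this
  have hDn : D.card ≤ n := by simpa using Finset.card_le_univ D
  rw [hsplit, Finset.card_union_of_disjoint hdisj, Finset.card_product, Finset.card_compl,
    Fintype.card_fin]
  push_cast [Nat.cast_sub hDn]
  linarith

theorem bad_card {n : ℕ} (D : Finset (Fin n)) (t : ℕ) :
    ((Finset.univ.filter (badEvent D t)).card : ℝ) / Fintype.card (Fin n → Fin t → Bool)
      ≤ ((n : ℝ) * D.card - D.card * (D.card + 1) / 2) / 2 ^ t := by
  rw [← pairs_card D]
  set Q := (D ×ˢ Finset.univ).filter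
      (fun p : Fin n × Fin n => p.2 ≠ p.1 ∧ (p.2 ∉ D ∨ p.2 < p.1)) with hQ
  have hsub : Finset.univ.filter (badEvent D t) ⊆
      Q.biUnion (fun p => Finset.univ.filter
        (fun s : Fin n → Fin t → Bool => s p.2 = s p.1)) := by
    intro s hs
    obtain ⟨d, hd, c, hcd, he⟩ := (Finset.mem_filter.mp hs).2
    simp only [Finset.mem_biUnion, Finset.mem_filter, Finset.mem_univ, true_and, hQ,
      Finset.mem_product, and_true]
    by_cases hc : c ∈ D ∧ d < c
    · exact ⟨(c, d), ⟨hc.1, hcd.symm, Or.inr hc.2⟩, he.symm⟩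
    · refine ⟨(d, c), ⟨hd, hcd, ?_⟩, he⟩
      by_cases h : c ∈ D
      · exact Or.inr (lt_of_le_of_ne (not_lt.mp fun h' => hc ⟨h, h'⟩) hcd)
      · exact Or.inl h
  have h1 : (Finset.univ.filter (badEvent D t)).card * 2 ^ t
      ≤ Q.card * Fintype.card (Fin n → Fin t → Bool) := by
    calc (Finset.univ.filter (badEvent D t)).card * 2 ^ t
        ≤ (∑ p ∈ Q, (Finset.univ.filter
        (fun s : Fin n → Fin t → Bool => s p.2 = s p.1)).card) * 2 ^ t := by
          gcongr
          exact (Finset.card_le_card hsub).trans Finset.card_biUnion_le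
      _ = ∑ p ∈ Q, (Finset.univ.filter
        (fun s : Fin n → Fin t → Bool => s p.2 = s p.1)).card * 2 ^ t := Finset.sum_mul _ _ _
      _ ≤ ∑ p ∈ Q, Fintype.card (Fin n → Fin t → Bool) := by
          apply Finset.sum_le_sum
          intro p hp
          exact collide_card t _ _ (Finset.mem_filter.mp hp).2.1
      _ = _ := by simp
  have hpos : (0 : ℝ) < Fintype.card (Fin n → Fin t → Bool) := by
    exact_mod_cast Fintype.card_pos
  rw [div_le_div_iff₀ hpos (by positivity)]
  exact_mod_cast h1

/-- Coupling inequality in counting form. -/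
theorem coupling_count {A B : Type*} [Fintype A] [Fintype B] [DecidableEq B] (X Y : A → B) (P : A → Prop)
    [DecidablePred P]
    (h : ∀ a, ¬ P a → X a = Y a) :
    ∑ b, |((Finset.univ.filter (fun a => X a = b)).card : ℝ)
        - ((Finset.univ.filter (fun a => Y a = b)).card : ℝ)|
      ≤ 2 * ((Finset.univ.filter P).card : ℝ) := by
  have key : ∀ b, |((Finset.univ.filter (fun a => X a = b)).card : ℝ)
        - ((Finset.univ.filter (fun a => Y a = b)).card : ℝ)|
      ≤ ∑ a ∈ Finset.univ.filter P, ((if X a = b then (1 : ℝ) else 0)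
          + (if Y a = b then (1 : ℝ) else 0)) := by
    intro b
    rw [Finset.card_filter, Finset.card_filter]
    push_cast
    rw [← Finset.sum_sub_distrib]
    refine (Finset.abs_sum_le_sum_abs _ _).trans ?_
    rw [Finset.sum_filter]
    apply Finset.sum_le_sum
    intro a _
    by_cases hp : P a
    · rw [if_pos hp]
      split_ifs <;> norm_num
    · rw [if_neg hp, h a hp]; simp
  refine (Finset.sum_le_sum fun b _ => key b).trans ?_
  rw [Finset.sum_comm]
  simp only [Finset.sum_add_distrib, Finset.sum_ite_eq, Finset.mem_univ, if_true]
  simp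
  linarith

theorem map_uniform_toReal {A B : Type*} [Fintype A] [Nonempty A] [DecidableEq B]
    (X : A → B) (b : B) :
    ((PMF.uniformOfFintype A).map X b).toReal
      = ((Finset.univ.filter (fun a => X a = b)).card : ℝ) / Fintype.card A := by
  rw [PMF.map_apply, tsum_fintype]
  simp only [PMF.uniformOfFintype_apply]
  rw [ENNReal.toReal_sum]
  · rw [Finset.card_filter]
    push_cast
    rw [Finset.sum_div]
    apply Finset.sum_congr rfl
    intro a _
    by_cases h : X a = b
    · simp [h]
    · simp [h, Ne.symm h]
  · intro a _
    split_ifs <;> simp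

/-- Number of permutations whose inverse restricts to `g`. -/
theorem perm_count {n : ℕ} (D : Finset (Fin n)) (g : D → Fin n) (hg : Function.Injective g) :
    (Finset.univ.filter (fun π : Equiv.Perm (Fin n) => (fun d : D => π⁻¹ d.1) = g)).card
      * (Finset.univ.filter (fun g : D → Fin n => Function.Injective g)).card
      = Fintype.card (Equiv.Perm (Fin n)) := by
  have hconst : ∀ g' : D → Fin n, Function.Injective g' →
      (Finset.univ.filter (fun π : Equiv.Perm (Fin n) => (fun d : D => π⁻¹ d.1) = g')).card
      = (Finset.univ.filter (fun π : Equiv.Perm (Fin n) => (fun d : D => π⁻¹ d.1) = g)).card := by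
    intro g' hg'
    obtain ⟨τ, hτ⟩ : ∃ τ : Equiv.Perm (Fin n), ∀ d, τ (g' d) = g d := by
      refine ⟨((Equiv.ofInjective g' hg').symm.trans (Equiv.ofInjective g hg)).extendSubtype, ?_⟩
      intro d
      rw [Equiv.extendSubtype_apply_of_mem _ _ ⟨d, rfl⟩]
      simp
    apply Finset.card_bij (fun π _ => π * τ⁻¹)
    · intro π hπ
      simp only [Finset.mem_filter, Finset.mem_univ, true_and] at hπ ⊢
      funext d
      rw [← hτ d, ← hπ]
      simp
    · intro a _ b _ h; exact mul_right_cancel h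
    · intro π hπ
      simp only [Finset.mem_filter, Finset.mem_univ, true_and] at hπ
      refine ⟨π * τ, ?_, by simp⟩
      simp only [Finset.mem_filter, Finset.mem_univ, true_and]
      funext d
      have := congrFun hπ d
      simp only [mul_inv_rev, Equiv.Perm.mul_apply]
      rw [this, ← hτ d]
      simp
  have hsum := Finset.card_eq_sum_card_fiberwise
    (f := fun π : Equiv.Perm (Fin n) => (fun d : D => π⁻¹ d.1))
    (s := Finset.univ) (t := Finset.univ.filter (fun g : D → Fin n => Function.Injective g))
    (by
      intro π _
      simp only [Finset.coe_filter, Finset.mem_univ, true_and, Set.mem_ofPred_eq]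
      intro a b h
      exact Subtype.ext ((π⁻¹).injective h))
  rw [← Finset.card_univ, hsum, Finset.sum_congr rfl
    (fun g' h' => hconst g' (Finset.mem_filter.mp h').2)]
  simp [mul_comm]

/-- Averaging over the starting order gives the uniform law. -/
theorem average_count {n : ℕ} (D : Finset (Fin n)) (t : ℕ) (g : D → Fin n) :
    ∑ π : Equiv.Perm (Fin n), (Finset.univ.filter (fun s => posMap D t π s = g)).card
      = Fintype.card (Fin n → Fin t → Bool) *
        (Finset.univ.filter (fun π : Equiv.Perm (Fin n) => (fun d : D => π⁻¹ d.1) = g)).card := by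
  have h1 : ∀ π : Equiv.Perm (Fin n),
      (Finset.univ.filter (fun s => posMap D t π s = g)).card
      = ∑ s : Fin n → Fin t → Bool,
        if (fun d : D => ((Tuple.sort (fun p => strVal t (s p))).trans π)⁻¹ d.1) = g
          then 1 else 0 := by
    intro π
    rw [Finset.card_filter]
    apply Fintype.sum_equiv (Equiv.arrowCongr π.symm (Equiv.refl _))
    intro s
    rfl
  simp_rw [h1]
  rw [Finset.sum_comm]
  have h2 : ∀ s : Fin n → Fin t → Bool, (∑ π : Equiv.Perm (Fin n),
        if (fun d : D => ((Tuple.sort (fun p => strVal t (s p))).trans π)⁻¹ d.1) = g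
          then 1 else 0)
      = (Finset.univ.filter
          (fun π : Equiv.Perm (Fin n) => (fun d : D => π⁻¹ d.1) = g)).card := by
    intro s
    rw [Finset.card_filter]
    apply Fintype.sum_equiv (Equiv.mulRight (Tuple.sort (fun p => strVal t (s p))))
    intro π
    rfl
  rw [Finset.sum_congr rfl (fun s _ => h2 s)]
  simp

theorem uniform_toReal {n : ℕ} (D : Finset (Fin n)) (t : ℕ) (g : D → Fin n)
    (hne : (Finset.univ.filter (fun g : D → Fin n => Function.Injective g)).Nonempty) :
    (PMF.uniformOfFinset
          (Finset.univ.filter (fun g : D → Fin n => Function.Injective g)) hne g).toReal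
      = (∑ π : Equiv.Perm (Fin n),
        ((Finset.univ.filter (fun s => posMap D t π s = g)).card : ℝ) /
          Fintype.card (Fin n → Fin t → Bool)) / Fintype.card (Equiv.Perm (Fin n)) := by
  have hpos : (Fintype.card (Fin n → Fin t → Bool) : ℝ) ≠ 0 := by
    exact_mod_cast Fintype.card_ne_zero
  have hpos2 : (Fintype.card (Equiv.Perm (Fin n)) : ℝ) ≠ 0 := by
    exact_mod_cast Fintype.card_ne_zero
  have hav : ∑ π : Equiv.Perm (Fin n),
        ((Finset.univ.filter (fun s => posMap D t π s = g)).card : ℝ)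
      = (Fintype.card (Fin n → Fin t → Bool) : ℝ) *
        ((Finset.univ.filter
          (fun π : Equiv.Perm (Fin n) => (fun d : D => π⁻¹ d.1) = g)).card : ℝ) := by
    exact_mod_cast average_count D t g
  rw [← Finset.sum_div, hav, mul_div_cancel_left₀ _ hpos, PMF.uniformOfFinset_apply]
  by_cases hg : Function.Injective g
  · rw [if_pos (by simpa using hg)]
    have hc : ((Finset.univ.filter
          (fun π : Equiv.Perm (Fin n) => (fun d : D => π⁻¹ d.1) = g)).card : ℝ)
        * ((Finset.univ.filter (fun g : D → Fin n => Function.Injective g)).card : ℝ)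
        = (Fintype.card (Equiv.Perm (Fin n)) : ℝ) := by
      exact_mod_cast perm_count D g hg
    have hne' : ((Finset.univ.filter
        (fun g : D → Fin n => Function.Injective g)).card : ℝ) ≠ 0 := by
      exact_mod_cast (Finset.card_pos.mpr hne).ne'
    rw [ENNReal.toReal_inv, ENNReal.toReal_natCast, eq_div_iff hpos2, ← hc]
    field_simp
  · rw [if_neg (by simpa using hg)]
    have : Finset.univ.filter
          (fun π : Equiv.Perm (Fin n) => (fun d : D => π⁻¹ d.1) = g) = ∅ := by
      rw [Finset.filter_eq_empty_iff]
      intro π _ h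
      apply hg
      rw [← h]
      intro a b hab
      exact Subtype.ext ((π⁻¹).injective hab)
    rw [this]
    simp

theorem tv_main {n : ℕ} (D : Finset (Fin n)) (t : ℕ) (σ₀ : Equiv.Perm (Fin n))
    (hne : (Finset.univ.filter (fun g : D → Fin n => Function.Injective g)).Nonempty) :
    tvDist ((PMF.uniformOfFintype (Fin n → Fin t → Bool)).map (posMap D t σ₀))
        (PMF.uniformOfFinset
          (Finset.univ.filter (fun g : D → Fin n => Function.Injective g)) hne)
      ≤ ((n : ℝ) * D.card - D.card * (D.card + 1) / 2) / 2 ^ t := by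
  refine le_trans ?_ (bad_card D t)
  unfold tvDist
  set N : ℝ := ((Fintype.card (Fin n → Fin t → Bool) : ℕ) : ℝ) with hN
  set F : ℝ := ((Fintype.card (Equiv.Perm (Fin n)) : ℕ) : ℝ) with hF
  have hNpos : 0 < N := by rw [hN]; exact_mod_cast Fintype.card_pos
  have hFpos : 0 < F := by rw [hF]; exact_mod_cast Fintype.card_pos
  have hb : ∀ g : D → Fin n,
      |(((PMF.uniformOfFintype (Fin n → Fin t → Bool)).map (posMap D t σ₀)) g).toReal
        - (PMF.uniformOfFinset
          (Finset.univ.filter (fun g : D → Fin n => Function.Injective g)) hne g).toReal|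
      ≤ (∑ π : Equiv.Perm (Fin n),
        |((Finset.univ.filter (fun s => posMap D t σ₀ s = g)).card : ℝ)
          - ((Finset.univ.filter (fun s => posMap D t π s = g)).card : ℝ)|) / (N * F) := by
    intro g
    rw [map_uniform_toReal, uniform_toReal D t g hne, ← hN, ← hF]
    have : ((Finset.univ.filter (fun s => posMap D t σ₀ s = g)).card : ℝ) / N
        - (∑ π : Equiv.Perm (Fin n),
        ((Finset.univ.filter (fun s => posMap D t π s = g)).card : ℝ) / N) / F
        = (∑ π : Equiv.Perm (Fin n),
        (((Finset.univ.filter (fun s => posMap D t σ₀ s = g)).card : ℝ)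
          - ((Finset.univ.filter (fun s => posMap D t π s = g)).card : ℝ))) / (N * F) := by
      rw [Finset.sum_sub_distrib, ← Finset.sum_div, Finset.sum_const, Finset.card_univ,
        nsmul_eq_mul, ← hF]
      field_simp
    rw [this, abs_div, abs_of_pos (mul_pos hNpos hFpos)]
    gcongr
    exact Finset.abs_sum_le_sum_abs _ _
  have hs := Finset.sum_le_sum (s := Finset.univ) (fun g _ => hb g)
  rw [← Finset.sum_div, Finset.sum_comm] at hs
  have hs2 : ∑ π : Equiv.Perm (Fin n), ∑ g : D → Fin n,
        |((Finset.univ.filter (fun s => posMap D t σ₀ s = g)).card : ℝ)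
          - ((Finset.univ.filter (fun s => posMap D t π s = g)).card : ℝ)|
      ≤ F * (2 * ((Finset.univ.filter (badEvent D t)).card : ℝ)) := by
    refine (Finset.sum_le_sum (fun π _ => coupling_count (posMap D t σ₀) (posMap D t π)
      (badEvent D t) (fun s h => posMap_eq D t σ₀ π s h))).trans ?_
    rw [Finset.sum_const, Finset.card_univ, nsmul_eq_mul]
  have hs3 := hs.trans (div_le_div_of_nonneg_right hs2 (mul_pos hNpos hFpos).le)
  have he : F * (2 * ((Finset.univ.filter (badEvent D t)).card : ℝ)) / (N * F)
      = 2 * (((Finset.univ.filter (badEvent D t)).card : ℝ) / N) := by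
    field_simp
  rw [he] at hs3
  linarith

/-- After `t` inverse riffle shuffles from any fixed order, the joint distribution of the
positions of the `k` cards in `D` (as a function `D → Fin n`, necessarily injective) is within
`(nk - k(k+1)/2)/2^t` of the uniform distribution on injective functions `D → Fin n`; in
particular it is within `nk/2^t`, hence within `ε` once `t ≥ log₂ n + log₂ k - log₂ ε`. -/
theorem riffle_positions_of_k_cards (n : ℕ) [NeZero n] (hn : 2 ≤ n)
    (D : Finset (Fin n)) (k : ℕ) (hD : D.card = k) (hk1 : 1 ≤ k) (hkn : k ≤ n)
    (σ₀ : Equiv.Perm (Fin n)) :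
    (∀ t : ℕ,
      tvDist ((PMF.uniformOfFintype (Fin n → Fin t → Bool)).map
          (fun s => fun d : D => (riffleResult t σ₀ s)⁻¹ d.1))
        (PMF.uniformOfFinset
          (Finset.univ.filter (fun g : D → Fin n => Function.Injective g))
          ⟨fun d => d.1, Finset.mem_filter.mpr ⟨Finset.mem_univ _, Subtype.val_injective⟩⟩)
      ≤ ((n : ℝ) * k - k * (k + 1) / 2) / 2 ^ t)
    ∧ (∀ t : ℕ,
      tvDist ((PMF.uniformOfFintype (Fin n → Fin t → Bool)).map
          (fun s => fun d : D => (riffleResult t σ₀ s)⁻¹ d.1))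
        (PMF.uniformOfFinset
          (Finset.univ.filter (fun g : D → Fin n => Function.Injective g))
          ⟨fun d => d.1, Finset.mem_filter.mpr ⟨Finset.mem_univ _, Subtype.val_injective⟩⟩)
      ≤ (n : ℝ) * k / 2 ^ t)
    ∧ ∀ ε : ℝ, 0 < ε → ∀ t : ℕ,
        Real.logb 2 (n : ℝ) + Real.logb 2 (k : ℝ) - Real.logb 2 ε ≤ (t : ℝ) →
        tvDist ((PMF.uniformOfFintype (Fin n → Fin t → Bool)).map
            (fun s => fun d : D => (riffleResult t σ₀ s)⁻¹ d.1))
          (PMF.uniformOfFinset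
            (Finset.univ.filter (fun g : D → Fin n => Function.Injective g))
            ⟨fun d => d.1, Finset.mem_filter.mpr ⟨Finset.mem_univ _, Subtype.val_injective⟩⟩)
        ≤ ε := by
  have h1 : ∀ t : ℕ,
      tvDist ((PMF.uniformOfFintype (Fin n → Fin t → Bool)).map
          (fun s => fun d : D => (riffleResult t σ₀ s)⁻¹ d.1))
        (PMF.uniformOfFinset
          (Finset.univ.filter (fun g : D → Fin n => Function.Injective g))
          ⟨fun d => d.1, Finset.mem_filter.mpr ⟨Finset.mem_univ _, Subtype.val_injective⟩⟩)
      ≤ ((n : ℝ) * k - k * (k + 1) / 2) / 2 ^ t := by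
    intro t
    rw [← hD]
    exact tv_main D t σ₀ _
  have h2 : ∀ t : ℕ, ((n : ℝ) * k - k * (k + 1) / 2) / 2 ^ t ≤ (n : ℝ) * k / 2 ^ t := by
    intro t
    gcongr
    have : (0 : ℝ) ≤ k * (k + 1) / 2 := by positivity
    linarith
  refine ⟨h1, fun t => (h1 t).trans (h2 t), fun ε hε t ht => (h1 t).trans ((h2 t).trans ?_)⟩
  have hn0 : (0 : ℝ) < n := by exact_mod_cast (by omega : 0 < n)
  have hk0 : (0 : ℝ) < k := by exact_mod_cast (by omega : 0 < k)
  rw [← Real.logb_mul hn0.ne' hk0.ne', ← Real.logb_div (by positivity) hε.ne',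
    Real.logb_le_iff_le_rpow (by norm_num) (by positivity), Real.rpow_natCast,
    div_le_iff₀ hε] at ht
  rw [div_le_iff₀ (by positivity)]
  linarith
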